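/- arXiv:2507.20566 — 2 statements merged into one kernel-verified Lean document; each statement's English description precedes it below -/
import Mathlib

section
/- Let 𝓔 be a finite set of entities with N = |𝓔| ≥ 2, and let (I, w, y_l, f) be a forgetting dataset over 𝓔. Define the unlearning objective E_u = Σ_{i∈I} w_i · f_i(y_l(i)), the total score C = Σ_{i∈I} w_i · Σ_{y∈𝓔} f_i(y), and the preference objective under uniform complement sampling E_p = Σ_{i∈I} w_i · ( f_i(y_l(i)) − (1/(N−1)) · Σ_{y∈𝓔, y≠y_l(i)} f_i(y) ). Then E_p = (N/(N−1)) · E_u − C/(N−1). -/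
/-- **Equivalence of optimization objectives (uniform complement sampling).**
For a forgetting dataset `(I, w, yl, f)` over a finite entity set `𝓔` with
`N = |𝓔| ≥ 2`, the preference objective `E_p` (with the preferred entity drawn
uniformly from `𝓔 \ {yl i}`) equals `(N/(N-1)) · E_u − C/(N-1)`, where `E_u` is
the unlearning objective and `C` the total score. -/
theorem preference_eq_linear_unlearning
    {E ι : Type*} [Fintype E] [DecidableEq E]
    (hN : 2 ≤ Fintype.card E)
    (I : Finset ι) (w : ι → ℝ) (yl : ι → E) (f : ι → E → ℝ)
    (hw : ∀ i ∈ I, 0 ≤ w i) (hw1 : ∑ i ∈ I, w i = 1) :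
    (∑ i ∈ I, w i * (f i (yl i) -
        (1 / ((Fintype.card E : ℝ) - 1)) * ∑ y ∈ Finset.univ \ {yl i}, f i y))
      = ((Fintype.card E : ℝ) / ((Fintype.card E : ℝ) - 1)) *
          (∑ i ∈ I, w i * f i (yl i))
        - (∑ i ∈ I, w i * ∑ y : E, f i y) / ((Fintype.card E : ℝ) - 1) := by
  have h2 : (2 : ℝ) ≤ (Fintype.card E : ℝ) := by exact_mod_cast hN
  have h0 : (Fintype.card E : ℝ) - 1 ≠ 0 := by linarith
  rw [Finset.mul_sum, Finset.sum_div, ← Finset.sum_sub_distrib]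
  refine Finset.sum_congr rfl fun i _ => ?_
  have h := Finset.sum_sdiff (f := f i) (Finset.subset_univ {yl i})
  rw [Finset.sum_singleton] at h
  rw [← h]
  field_simp
  ring
end

section
/- Let 𝓔 be a finite set of entities with N = |𝓔| ≥ 2, and let (I, w, y_l, f) be a forgetting dataset over 𝓔 equipped with boundary sets B_i ⊆ 𝓔 \ {y_l(i)} of common cardinality k for all i, where N − 1 − k ≥ 1. Define the unlearning objective E_u = Σ_{i∈I} w_i · f_i(y_l(i)), the total score C = Σ_{i∈I} w_i · Σ_{y∈𝓔} f_i(y), the boundary score S = Σ_{i∈I} w_i · Σ_{e∈B_i} f_i(e), and the out-boundary preference objective E_p' = Σ_{i∈I} w_i · ( f_i(y_l(i)) − (1/(N−1−k)) · Σ_{y ∈ 𝓔 \ (B_i ∪ {y_l(i)})} f_i(y) ). Then E_p' = ((N−k)/(N−1−k)) · E_u − (C − S)/(N−1−k). -/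
/-- **Preservation of the optimization objective under out-boundary sampling.**
For a forgetting dataset `(I, w, yl, f)` over a finite entity set `𝓔` with
`N = |𝓔| ≥ 2`, equipped with boundary sets `B i ⊆ 𝓔 \ {yl i}` of common
cardinality `k` with `N − 1 − k ≥ 1`, the out-boundary preference objective
equals `((N−k)/(N−1−k)) · E_u − (C − S)/(N−1−k)`, where `E_u` is the unlearning
objective, `C` the total score, and `S` the boundary score. -/
theorem out_boundary_preference_eq_linear_unlearning
    {E ι : Type*} [Fintype E] [DecidableEq E]
    (hN : 2 ≤ Fintype.card E)
    (I : Finset ι) (w : ι → ℝ) (yl : ι → E) (f : ι → E → ℝ)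
    (hw : ∀ i ∈ I, 0 ≤ w i) (hw1 : ∑ i ∈ I, w i = 1)
    (B : ι → Finset E) (k : ℕ)
    (hBsub : ∀ i ∈ I, yl i ∉ B i)
    (hBcard : ∀ i ∈ I, (B i).card = k)
    (hk : 1 ≤ Fintype.card E - 1 - k) :
    (∑ i ∈ I, w i * (f i (yl i) -
        (1 / ((Fintype.card E : ℝ) - 1 - (k : ℝ))) *
          ∑ y ∈ Finset.univ \ (insert (yl i) (B i)), f i y))
      = (((Fintype.card E : ℝ) - (k : ℝ)) / ((Fintype.card E : ℝ) - 1 - (k : ℝ))) *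
          (∑ i ∈ I, w i * f i (yl i))
        - ((∑ i ∈ I, w i * ∑ y : E, f i y) - ∑ i ∈ I, w i * ∑ e ∈ B i, f i e)
            / ((Fintype.card E : ℝ) - 1 - (k : ℝ)) := by
  have hD : (Fintype.card E : ℝ) - 1 - (k : ℝ) ≠ 0 := by
    have h : k + 2 ≤ Fintype.card E := by omega
    have h2 : (k : ℝ) + 2 ≤ (Fintype.card E : ℝ) := by exact_mod_cast h
    intro h0
    linarith
  rw [← Finset.sum_sub_distrib, Finset.mul_sum, Finset.sum_div, ← Finset.sum_sub_distrib]
  refine Finset.sum_congr rfl fun i hi => ?_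
  have h1 := Finset.sum_sdiff (f := f i) (Finset.subset_univ (insert (yl i) (B i)))
  rw [Finset.sum_insert (hBsub i hi)] at h1
  rw [← h1]
  field_simp
  ring
end
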